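/- Let Ω ⊂ ℝ^d be a bounded domain, r ∈ [1,∞), and let v : Ω × ℝ^d → ℝ be such that v(·,y) is measurable for each y, v(x,·) is continuous and Y-periodic for a.e. x ∈ Ω, and ∫_Ω (sup_{y∈Y} |v(x,y)|)^r dx < ∞. Define v^ε : ℝ^d → ℝ by v^ε(x) = v(x, x/ε) for x ∈ Ω and v^ε(x) = 0 otherwise, and let ṽ(x,y) = v(x,y) for x ∈ Ω and ṽ(x,y) = 0 otherwise. Then ∫_{ℝ^d} ∫_Y |v^ε(T_ε(x,y)) − ṽ(x,y)|^r dy dx → 0 as ε → 0, i.e. v^ε converges strongly two-scale to v in L^r(Ω × Y). -/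

import Mathlib

open MeasureTheory Filter Set

noncomputable section

/-- The unit cell `Y = (0,1]^d`. -/
def Ycell (d : ℕ) : Set (EuclideanSpace ℝ (Fin d)) :=
  {y | ∀ i, y i ∈ Set.Ioc (0 : ℝ) 1}

/-- The componentwise floor map `N(x) = (⌊x₁⌋, …, ⌊x_d⌋)` (viewed in `ℝ^d`). -/
def Ncell {d : ℕ} (x : EuclideanSpace ℝ (Fin d)) : EuclideanSpace ℝ (Fin d) :=
  WithLp.toLp 2 fun i => (⌊x i⌋ : ℝ)

/-- The two-scale composition function `T_ε(x,y) = ε (N(x/ε) + y)`. -/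
def Tcell {d : ℕ} (ε : ℝ) (x y : EuclideanSpace ℝ (Fin d)) :
    EuclideanSpace ℝ (Fin d) :=
  ε • (Ncell (ε⁻¹ • x) + y)

/-- Interpret a bare vector of `Fin d → ℝ` as an element of `ℝ^d`. -/
def toE {d : ℕ} (v : Fin d → ℝ) : EuclideanSpace ℝ (Fin d) := WithLp.toLp 2 v

lemma measurableSet_Ycell (d : ℕ) : MeasurableSet (Ycell d) := by
  have : Ycell d = ⋂ i, (fun y : EuclideanSpace ℝ (Fin d) => y i) ⁻¹' Set.Ioc (0 : ℝ) 1 := by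
    ext y; simp [Ycell]
  rw [this]
  exact MeasurableSet.iInter fun i => (by fun_prop : Measurable _) measurableSet_Ioc

lemma measurable_Ncell {d : ℕ} : Measurable (Ncell : EuclideanSpace ℝ (Fin d) → _) := by
  unfold Ncell
  refine (WithLp.measurable_toLp 2 _).comp (measurable_pi_lambda _ fun i => ?_)
  exact (measurable_from_top (f := fun n : ℤ => (n : ℝ))).comp
    (Int.measurable_floor.comp (by fun_prop))

lemma volume_forall_mem {d : ℕ} (s : Fin d → Set ℝ) (hs : ∀ i, MeasurableSet (s i)) :
    volume {x : EuclideanSpace ℝ (Fin d) | ∀ i, x i ∈ s i} = ∏ i, volume (s i) := by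
  rw [← volume_pi_pi, ← (PiLp.volume_preserving_ofLp (Fin d)).measure_preimage
    (MeasurableSet.univ_pi hs).nullMeasurableSet]
  congr 1
  ext x
  simp

lemma volume_Ycell (d : ℕ) : volume (Ycell d) = 1 :=
  (volume_forall_mem (fun _ => Set.Ioc (0 : ℝ) 1) fun _ => measurableSet_Ioc).trans (by simp)

instance isProbabilityMeasure_restrict_Ycell (d : ℕ) :
    IsProbabilityMeasure (volume.restrict (Ycell d)) :=
  ⟨by simp [volume_Ycell]⟩

lemma EuclideanSpace.norm_le_sqrt_card {d : ℕ} {x : EuclideanSpace ℝ (Fin d)}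
    (hx : ∀ i, |x i| ≤ 1) : ‖x‖ ≤ √d := by
  rw [EuclideanSpace.norm_eq]
  refine Real.sqrt_le_sqrt ?_
  calc ∑ i, ‖x i‖ ^ 2 ≤ ∑ _i : Fin d, (1 : ℝ) :=
        Finset.sum_le_sum fun i _ => pow_le_one₀ (norm_nonneg _) (hx i)
    _ = d := by simp

lemma isBounded_Ycell (d : ℕ) : Bornology.IsBounded (Ycell d) :=
  isBounded_iff_forall_norm_le.2 ⟨√d, fun y hy => EuclideanSpace.norm_le_sqrt_card fun i =>
    abs_le.2 ⟨by linarith [(hy i).1], (hy i).2⟩⟩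

lemma norm_Tcell_sub_le {d : ℕ} {ε : ℝ} (hε : 0 < ε) (x : EuclideanSpace ℝ (Fin d))
    {y : EuclideanSpace ℝ (Fin d)} (hy : y ∈ Ycell d) : ‖Tcell ε x y - x‖ ≤ ε * √d := by
  have : Tcell ε x y - x = ε • (Ncell (ε⁻¹ • x) + y - ε⁻¹ • x) := by
    rw [Tcell, smul_sub, smul_inv_smul₀ hε.ne']
  rw [this, norm_smul, Real.norm_of_nonneg hε.le]
  gcongr
  refine EuclideanSpace.norm_le_sqrt_card fun i => ?_
  have h₁ := Int.floor_le ((ε⁻¹ • x) i)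
  have h₂ := Int.lt_floor_add_one ((ε⁻¹ • x) i)
  have h₃ := hy i
  simp only [Ncell, PiLp.add_apply, PiLp.sub_apply, abs_le] at *
  exact ⟨by linarith [h₃.1], by linarith [h₃.2]⟩

lemma measurable_Tcell {d : ℕ} (ε : ℝ) :
    Measurable fun z : EuclideanSpace ℝ (Fin d) × EuclideanSpace ℝ (Fin d) =>
      Tcell ε z.1 z.2 := by
  unfold Tcell
  exact ((measurable_Ncell.comp (measurable_fst.const_smul ε⁻¹)).add measurable_snd).const_smul ε

lemma volume_Ycell_inter_preimage_add {d : ℕ} (k : Fin d → ℤ)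
    (s : Set (EuclideanSpace ℝ (Fin d))) :
    volume ({y | toE (fun i => (k i : ℝ)) + y ∈ s} ∩ Ycell d) =
      volume (s ∩ {x | ∀ i, ⌈x i⌉ - 1 = k i}) := by
  rw [← measure_preimage_add volume (toE fun i => (k i : ℝ)) (s ∩ _)]
  congr 1
  ext y
  simp only [mem_inter_iff, mem_ofPred_eq, mem_preimage, Ycell, toE, PiLp.add_apply, mem_Ioc]
  refine and_congr_right fun _ => forall_congr' fun i => ?_
  rw [sub_eq_iff_eq_add, Int.ceil_eq_iff]
  push_cast
  constructor <;> rintro ⟨h₁, h₂⟩ <;> constructor <;> linarith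

/-- At scale one, unfolding preserves Lebesgue measure. -/
lemma measurePreserving_Ncell_add (d : ℕ) :
    MeasurePreserving
      (fun z : EuclideanSpace ℝ (Fin d) × EuclideanSpace ℝ (Fin d) => Ncell z.1 + z.2)
      (volume.prod (volume.restrict (Ycell d))) volume := by
  have hm : Measurable
      (fun z : EuclideanSpace ℝ (Fin d) × EuclideanSpace ℝ (Fin d) => Ncell z.1 + z.2) :=
    (measurable_Ncell.comp measurable_fst).add measurable_snd
  refine ⟨hm, Measure.ext fun s hs => ?_⟩
  let κ : EuclideanSpace ℝ (Fin d) → (Fin d → ℤ) := fun x i => ⌊x i⌋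
  let κ' : EuclideanSpace ℝ (Fin d) → (Fin d → ℤ) := fun x i => ⌈x i⌉ - 1
  have hκ : Measurable κ := measurable_pi_lambda _ fun i =>
    Int.measurable_floor.comp (by fun_prop)
  have hκ' : Measurable κ' := measurable_pi_lambda _ fun i =>
    (measurable_from_top (f := fun n : ℤ => n - 1)).comp
      (Int.measurable_ceil.comp (by fun_prop))
  have hκv (k : Fin d → ℤ) : volume (κ ⁻¹' {k}) = 1 := by
    have : κ ⁻¹' {k} = {x | ∀ i, x i ∈ Set.Ico (k i : ℝ) (k i + 1)} := by
      ext x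
      simp [κ, funext_iff, Int.floor_eq_iff]
    rw [this, volume_forall_mem _ fun _ => measurableSet_Ico]
    simp
  have hcover {f : EuclideanSpace ℝ (Fin d) → (Fin d → ℤ)} : ⋃ k, f ⁻¹' {k} = univ := by
    ext x; simp
  have hdisj {f : EuclideanSpace ℝ (Fin d) → (Fin d → ℤ)} :
      Pairwise (Function.onFun Disjoint fun k => f ⁻¹' {k}) := fun a b hab =>
    Disjoint.preimage f (by simpa using hab)
  rw [Measure.map_apply hm hs, Measure.prod_apply (hm hs), ← setLIntegral_univ, ← hcover (f := κ),
    lintegral_iUnion (fun k => hκ (measurableSet_singleton k)) hdisj]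
  have hcell (k : Fin d → ℤ) :
      ∫⁻ x in κ ⁻¹' {k}, volume.restrict (Ycell d) (Prod.mk x ⁻¹'
        ((fun z : EuclideanSpace ℝ (Fin d) × EuclideanSpace ℝ (Fin d) => Ncell z.1 + z.2) ⁻¹' s)) =
      volume (s ∩ κ' ⁻¹' {k}) := by
    have h : ∀ x ∈ κ ⁻¹' {k}, volume.restrict (Ycell d) (Prod.mk x ⁻¹'
        ((fun z : EuclideanSpace ℝ (Fin d) × EuclideanSpace ℝ (Fin d) => Ncell z.1 + z.2) ⁻¹' s)) =
        volume (s ∩ κ' ⁻¹' {k}) := by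
      intro x hx
      have hN : Ncell x = toE fun i => (k i : ℝ) := by
        rw [← (show κ x = k from hx)]; rfl
      have hset : κ' ⁻¹' {k} = {x | ∀ i, ⌈x i⌉ - 1 = k i} := by
        ext z
        exact funext_iff
      rw [Measure.restrict_apply' (measurableSet_Ycell d), hset,
        ← volume_Ycell_inter_preimage_add, ← hN]
      rfl
    rw [setLIntegral_congr_fun (hκ (measurableSet_singleton k)) h, setLIntegral_const, hκv, mul_one]
  simp_rw [hcell]
  rw [← measure_iUnion (fun a b hab => (hdisj hab).mono inter_subset_right inter_subset_right)
    fun k => hs.inter (hκ' (measurableSet_singleton k)), ← inter_iUnion, hcover, inter_univ]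

/-- Unfolding preserves Lebesgue measure at every scale. -/
lemma measurePreserving_Tcell (d : ℕ) {ε : ℝ} (hε : 0 < ε) :
    MeasurePreserving
      (fun z : EuclideanSpace ℝ (Fin d) × EuclideanSpace ℝ (Fin d) => Tcell ε z.1 z.2)
      (volume.prod (volume.restrict (Ycell d))) volume := by
  let c : ENNReal := ENNReal.ofReal |(ε⁻¹ ^ d)⁻¹|
  have hscale : MeasurePreserving
      (Prod.map (ε⁻¹ • ·) id : EuclideanSpace ℝ (Fin d) × EuclideanSpace ℝ (Fin d) → _)
      (volume.prod (volume.restrict (Ycell d)))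
      (c • volume.prod (volume.restrict (Ycell d))) := by
    rw [← Measure.prod_smul_left]
    refine MeasurePreserving.prod ⟨measurable_const_smul _, ?_⟩ (MeasurePreserving.id _)
    simp [Measure.map_addHaar_smul volume (inv_ne_zero hε.ne'), c]
  have hunscale : MeasurePreserving (ε • · : EuclideanSpace ℝ (Fin d) → _)
      (c • volume) volume := by
    refine ⟨measurable_const_smul _, ?_⟩
    rw [Measure.map_smul, Measure.map_addHaar_smul volume hε.ne', smul_smul,
      ← ENNReal.ofReal_mul (abs_nonneg _), ← abs_mul, finrank_euclideanSpace_fin, inv_pow, inv_inv,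
      mul_inv_cancel₀ (pow_ne_zero _ hε.ne')]
    simp
  have hunit := (measurePreserving_Ncell_add d).smul_measure c
  have hcomp := hunscale.comp (hunit.comp hscale)
  exact hcomp

lemma ContinuousMap.stronglyMeasurable_of_eval {X K : Type*} [MeasurableSpace X]
    [TopologicalSpace K] [CompactSpace K] [LocallyCompactSpace K] [SecondCountableTopology K]
    {F : X → C(K, ℝ)} (hF : ∀ k, Measurable fun x => F x k) : StronglyMeasurable F := by
  borelize C(K, ℝ)
  refine Measurable.stronglyMeasurable ?_
  obtain ⟨D, hDc, hD⟩ := TopologicalSpace.exists_countable_dense K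
  have hdist (f : C(K, ℝ)) : Measurable fun x => dist (F x) f := by
    refine measurable_of_Iic fun c => ?_
    rcases lt_or_ge c 0 with hc | hc
    · convert MeasurableSet.empty
      ext x
      simpa using hc.trans_le dist_nonneg
    · have : (fun x => dist (F x) f) ⁻¹' Set.Iic c =
          ⋂ k ∈ D, (fun x => dist (F x k) (f k)) ⁻¹' Set.Iic c := by
        ext x
        simp only [mem_preimage, mem_Iic, mem_iInter, ContinuousMap.dist_le hc]
        refine ⟨fun h k _ => h k, fun h k => ?_⟩
        have hclosed : IsClosed {k | dist (F x k) (f k) ≤ c} :=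
          isClosed_le (by fun_prop) continuous_const
        exact hclosed.closure_subset_iff.2 h (hD k)
      rw [this]
      exact MeasurableSet.biInter hDc fun k _ => ((hF k).dist measurable_const) measurableSet_Iic
  refine measurable_of_isOpen fun U hU => ?_
  choose! ρ hρ hρU using Metric.isOpen_iff.1 hU
  obtain ⟨T, hTU, hTc, hT⟩ := TopologicalSpace.isOpen_biUnion_countable U
    (fun f => Metric.ball f (ρ f)) fun _ _ => Metric.isOpen_ball
  have hUeq : U = ⋃ f ∈ T, Metric.ball f (ρ f) :=
    hT ▸ Subset.antisymm (fun f hf => mem_biUnion hf (Metric.mem_ball_self (hρ f hf)))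
      (iUnion₂_subset hρU)
  rw [hUeq, preimage_iUnion₂]
  exact MeasurableSet.biUnion hTc fun f _ => hdist f measurableSet_Iio

lemma HasCompactSupport.tendsto_eLpNorm_Tcell_sub {d : ℕ} {E : Type*} [NormedAddCommGroup E]
    {p : ENNReal} {g : EuclideanSpace ℝ (Fin d) → E} (hg : HasCompactSupport g)
    (hgc : Continuous g) :
    Tendsto (fun ε : ℝ => eLpNorm
        (fun z : EuclideanSpace ℝ (Fin d) × EuclideanSpace ℝ (Fin d) =>
          g (Tcell ε z.1 z.2) - g z.1) p (volume.prod (volume.restrict (Ycell d))))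
      (nhdsWithin 0 (Set.Ioi 0)) (nhds 0) := by
  obtain ⟨R, hR⟩ := hg.isCompact.isBounded.exists_norm_le
  set s : Set (EuclideanSpace ℝ (Fin d)) := Metric.closedBall 0 (R + √d)
  set μ := (volume : Measure (EuclideanSpace ℝ (Fin d))).prod (volume.restrict (Ycell d))
  set M : ENNReal := μ (s ×ˢ univ) ^ (1 / p.toReal)
  have hM : M ≠ ⊤ := by
    refine ENNReal.rpow_ne_top_of_nonneg (by positivity) ?_
    rw [Measure.prod_prod, measure_univ, mul_one]
    exact measure_closedBall_lt_top.ne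
  have hlim : Tendsto (fun η : ℝ => M * ENNReal.ofReal η) (nhdsWithin 0 (Set.Ioi 0)) (nhds 0) := by
    have := ENNReal.Tendsto.const_mul (a := M) (ENNReal.tendsto_ofReal
      (tendsto_id.mono_left (nhdsWithin_le_nhds (a := (0 : ℝ)) (s := Set.Ioi 0)))) (Or.inr hM)
    simpa using this
  refine ENNReal.tendsto_nhds_zero.2 fun δ hδ => ?_
  obtain ⟨η, hηδ, hη⟩ := ((hlim.eventually (ge_mem_nhds hδ)).and self_mem_nhdsWithin).exists
  obtain ⟨ω, hω, hgω⟩ := Metric.uniformContinuous_iff.1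
    
    (hgc.uniformContinuous_of_tendsto_cocompact hg.is_zero_at_infty) η hη
  have hsmall : ∀ᶠ ε : ℝ in nhdsWithin 0 (Set.Ioi 0), ε * √d < ω := by
    have : Tendsto (fun ε : ℝ => ε * √d) (nhds 0) (nhds 0) := by
      simpa using (tendsto_id (α := ℝ) (x := nhds 0)).mul_const (√d)
    exact nhdsWithin_le_nhds (this.eventually (gt_mem_nhds hω))
  filter_upwards [hsmall, self_mem_nhdsWithin, nhdsWithin_le_nhds (gt_mem_nhds one_pos)]
    with ε hεω hε hε1
  have hY : ∀ᵐ z ∂μ, z.2 ∈ Ycell d :=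
    Measure.quasiMeasurePreserving_snd.ae (ae_restrict_mem (measurableSet_Ycell d))
  have hzero {x : EuclideanSpace ℝ (Fin d)} (hx : R < ‖x‖) : g x = 0 :=
    image_eq_zero_of_notMem_tsupport fun h => hx.not_ge (hR x h)
  have hbound : ∀ᵐ z ∂μ, ‖g (Tcell ε z.1 z.2) - g z.1‖ ≤
      ‖(s ×ˢ univ).indicator (fun _ => η) z‖ := by
    filter_upwards [hY] with z hz
    have hT := norm_Tcell_sub_le hε z.1 hz
    by_cases hzs : z ∈ s ×ˢ (univ : Set (EuclideanSpace ℝ (Fin d)))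
    · rw [indicator_of_mem hzs, Real.norm_of_nonneg (le_of_lt hη), ← dist_eq_norm]
      exact (hgω ((dist_eq_norm _ _).trans_lt (hT.trans_lt hεω))).le
    · have hz' : R + √d < ‖z.1‖ := by simpa [s] using hzs
      have h₁ : ε * √d ≤ √d := mul_le_of_le_one_left (Real.sqrt_nonneg _) hε1.le
      have h₂ := norm_sub_norm_le z.1 (Tcell ε z.1 z.2)
      rw [norm_sub_rev] at h₂
      rw [hzero (by linarith), hzero (by linarith [Real.sqrt_nonneg (d : ℝ)])]
      simp
  calc _ ≤ eLpNorm ((s ×ˢ univ).indicator fun _ => η) p μ := eLpNorm_mono_ae hbound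
    _ ≤ ‖η‖ₑ * M := eLpNorm_indicator_const_le _ _
    _ = M * ENNReal.ofReal η := by rw [Real.enorm_of_nonneg (le_of_lt hη), mul_comm]
    _ ≤ δ := hηδ

/-- Unfoldings of an `L^p` function converge to the function itself in `L^p`. -/
lemma MeasureTheory.MemLp.tendsto_eLpNorm_Tcell_sub {d : ℕ} {E : Type*} [NormedAddCommGroup E]
    [NormedSpace ℝ E] {p : ENNReal} (hp : 1 ≤ p) (hp_top : p ≠ ⊤)
    {G : EuclideanSpace ℝ (Fin d) → E} (hG : MemLp G p volume) :
    Tendsto (fun ε : ℝ => eLpNorm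
        (fun z : EuclideanSpace ℝ (Fin d) × EuclideanSpace ℝ (Fin d) =>
          G (Tcell ε z.1 z.2) - G z.1) p (volume.prod (volume.restrict (Ycell d))))
      (nhdsWithin 0 (Set.Ioi 0)) (nhds 0) := by
  refine ENNReal.tendsto_nhds_zero.2 fun δ hδ => ?_
  have hδ3 : δ / 3 ≠ 0 := (ENNReal.div_pos hδ.ne' (by simp)).ne'
  obtain ⟨g, hgs, hgG, hgc, hg⟩ := hG.exists_hasCompactSupport_eLpNorm_sub_le hp_top hδ3
  have hsub := hG.aestronglyMeasurable.sub hg.aestronglyMeasurable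
  filter_upwards [(hgs.tendsto_eLpNorm_Tcell_sub (p := p) hgc).eventually
    (ge_mem_nhds (pos_iff_ne_zero.2 hδ3)), self_mem_nhdsWithin] with ε hε hε0
  have hT := measurePreserving_Tcell d hε0
  have hfst : MeasurePreserving Prod.fst
      ((volume : Measure (EuclideanSpace ℝ (Fin d))).prod (volume.restrict (Ycell d))) volume :=
    measurePreserving_fst
  set f₁ : EuclideanSpace ℝ (Fin d) × EuclideanSpace ℝ (Fin d) → E :=
    (G - g) ∘ fun z => Tcell ε z.1 z.2
  set f₂ : EuclideanSpace ℝ (Fin d) × EuclideanSpace ℝ (Fin d) → E := (G - g) ∘ Prod.fst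
  set f₃ : EuclideanSpace ℝ (Fin d) × EuclideanSpace ℝ (Fin d) → E :=
    fun z => g (Tcell ε z.1 z.2) - g z.1
  have hf₁ := hsub.comp_measurePreserving hT
  have hf₂ := hsub.comp_measurePreserving hfst
  have hf₃ : AEStronglyMeasurable f₃
      ((volume : Measure (EuclideanSpace ℝ (Fin d))).prod (volume.restrict (Ycell d))) :=
    (hg.aestronglyMeasurable.comp_measurePreserving hT).sub
      (hg.aestronglyMeasurable.comp_measurePreserving hfst)
  have hdecomp : (fun z : EuclideanSpace ℝ (Fin d) × EuclideanSpace ℝ (Fin d) =>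
      G (Tcell ε z.1 z.2) - G z.1) = (f₁ - f₂) + f₃ := by
    ext z
    simp only [f₁, f₂, f₃, Pi.add_apply, Pi.sub_apply, Function.comp_apply]
    abel
  rw [hdecomp]
  calc _ ≤ _ := (eLpNorm_add_le (hf₁.sub hf₂) hf₃ hp).trans
        (add_le_add_left (eLpNorm_sub_le hf₁ hf₂ hp) _)
    _ ≤ δ / 3 + δ / 3 + δ / 3 := by
      rw [eLpNorm_comp_measurePreserving hsub hT, eLpNorm_comp_measurePreserving hsub hfst]
      gcongr
    _ = δ := ENNReal.add_thirds δ

lemma abs_le_iSup_of_mem_closure {X : Type*} [TopologicalSpace X] {s : Set X}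
    (hs : IsCompact (closure s)) {f : X → ℝ} (hf : Continuous f) {y : X} (hy : y ∈ closure s) :
    |f y| ≤ ⨆ y ∈ s, |f y| := by
  obtain ⟨C, hC⟩ := hs.exists_bound_of_continuousOn hf.continuousOn
  have hbdd : BddAbove (range fun y => ⨆ _ : y ∈ s, |f y|) := by
    refine ⟨max C 0, ?_⟩
    rintro _ ⟨z, rfl⟩
    by_cases hz : z ∈ s
    · simpa [hz] using Or.inl (hC z (subset_closure hz))
    · simp [hz]
  have hclosed : IsClosed {y | |f y| ≤ ⨆ y ∈ s, |f y|} := isClosed_le (by fun_prop) continuous_const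
  refine closure_minimal (fun z hz => ?_) hclosed hy
  exact (ciSup_pos (f := fun _ => |f z|) hz).ge.trans (le_ciSup hbdd z)

/-- strong two-scale convergence of oscillating functions:
let `Ω ⊂ ℝ^d` be a bounded domain, `r ∈ [1,∞)`, and `v : Ω × ℝ^d → ℝ` measurable in `x`
for each `y`, continuous and `Y`-periodic in `y` for a.e. `x ∈ Ω`, with
`∫_Ω (sup_{y∈Y} |v(x,y)|)^r dx < ∞`.  Define `v^ε(x) = v(x, x/ε)` on `Ω`, extended by
zero, and `ṽ(x,y) = v(x,y)` on `Ω`, extended by zero.  Then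
`∫_{ℝ^d} ∫_Y |v^ε(T_ε(x,y)) − ṽ(x,y)|^r dy dx → 0` as `ε → 0+`, i.e. `v^ε → v`
strongly two-scale in `L^r(Ω × Y)`. -/
theorem stmt3 {d : ℕ} (hd : 1 ≤ d)
    (Ω : Set (EuclideanSpace ℝ (Fin d))) (hΩo : IsOpen Ω)
    (hΩb : Bornology.IsBounded Ω)
    (r : ℝ) (hr : 1 ≤ r)
    (v : EuclideanSpace ℝ (Fin d) → EuclideanSpace ℝ (Fin d) → ℝ)
    (hmeas : ∀ y, Measurable fun x => v x y)
    (hcontper : ∀ᵐ x : EuclideanSpace ℝ (Fin d), x ∈ Ω →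
      Continuous (v x) ∧
      ∀ (y : EuclideanSpace ℝ (Fin d)) (k : Fin d → ℤ),
        v x (y + toE fun i => (k i : ℝ)) = v x y)
    (hint : IntegrableOn
      (fun x : EuclideanSpace ℝ (Fin d) => (⨆ y ∈ Ycell d, |v x y|) ^ r) Ω) :
    Tendsto
      (fun ε : ℝ =>
        ∫ x : EuclideanSpace ℝ (Fin d), ∫ y in Ycell d,
          |Set.indicator Ω (fun x' => v x' (ε⁻¹ • x')) (Tcell ε x y) -
            Set.indicator Ω (fun x' => v x' y) x| ^ r)
      (nhdsWithin 0 (Set.Ioi 0)) (nhds 0) := by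
  have hK : IsCompact (closure (Ycell d)) := (isBounded_Ycell d).isCompact_closure
  have : CompactSpace (closure (Ycell d)) := isCompact_iff_compactSpace.1 hK
  obtain ⟨t, ht, htm, ht0⟩ := exists_measurable_superset_of_null (ae_iff.1 hcontper)
  have hgood {x : EuclideanSpace ℝ (Fin d)} (hx : x ∈ Ω \ t) :
      Continuous (v x) ∧ ∀ (y : EuclideanSpace ℝ (Fin d)) (k : Fin d → ℤ),
        v x (y + toE fun i => (k i : ℝ)) = v x y :=
    by_contra fun h => hx.2 (ht fun h' => h (h' hx.1))
  have hAm : MeasurableSet (Ω \ t) := hΩo.measurableSet.diff htm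
  classical
  let G : EuclideanSpace ℝ (Fin d) → C(closure (Ycell d), ℝ) := fun x =>
    if hx : x ∈ Ω \ t then ⟨fun k => v x k, (hgood hx).1.comp continuous_subtype_val⟩ else 0
  have hG_apply (x : EuclideanSpace ℝ (Fin d)) (k : closure (Ycell d)) :
      G x k = (Ω \ t).indicator (fun x => v x k) x := by
    by_cases hx : x ∈ Ω \ t
    · rw [indicator_of_mem hx]
      simp only [G, dif_pos hx, ContinuousMap.coe_mk]
    · rw [indicator_of_notMem hx]
      simp only [G, dif_neg hx, ContinuousMap.zero_apply]
  have hGm : StronglyMeasurable G := ContinuousMap.stronglyMeasurable_of_eval fun k => by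
    simp_rw [hG_apply]
    exact (hmeas k).indicator hAm
  have hr0 : 0 < r := one_pos.trans_le hr
  set p := ENNReal.ofReal r
  have hp : 1 ≤ p := ENNReal.one_le_ofReal.2 hr
  have hp0 : p ≠ 0 := (one_pos.trans_le hp).ne'
  have hp_top : p ≠ ⊤ := ENNReal.ofReal_ne_top
  have hpr : p.toReal = r := ENNReal.toReal_ofReal hr0.le
  have hsup (x : EuclideanSpace ℝ (Fin d)) : 0 ≤ ⨆ y ∈ Ycell d, |v x y| :=
    Real.iSup_nonneg fun y => Real.iSup_nonneg fun _ => abs_nonneg _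
  have hGp : MemLp G p volume := by
    rw [← integrable_norm_rpow_iff hGm.aestronglyMeasurable hp0 hp_top, hpr]
    refine ((hint.mono_set sdiff_subset).integrable_indicator hAm).mono'
      (hGm.norm.measurable.pow_const r).aestronglyMeasurable (.of_forall fun x => ?_)
    rw [Real.norm_of_nonneg (by positivity)]
    by_cases hx : x ∈ Ω \ t
    · rw [indicator_of_mem hx]
      refine Real.rpow_le_rpow (norm_nonneg _) ?_ hr0.le
      refine (ContinuousMap.norm_le _ (hsup x)).2 fun k => ?_
      rw [hG_apply, indicator_of_mem hx]
      exact abs_le_iSup_of_mem_closure hK (hgood hx).1 k.2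
    · rw [indicator_of_notMem hx]
      simp only [G, dif_neg hx, norm_zero, Real.zero_rpow hr0.ne', le_refl]
  have hlim := ((ENNReal.continuous_rpow_const (y := r)).tendsto 0).comp
    (hGp.tendsto_eLpNorm_Tcell_sub hp hp_top)
  rw [ENNReal.zero_rpow_of_pos hr0] at hlim
  rw [tendsto_zero_iff_enorm_tendsto_zero]
  refine tendsto_of_tendsto_of_tendsto_of_le_of_le' tendsto_const_nhds hlim
    (.of_forall fun _ => zero_le) ?_
  filter_upwards [self_mem_nhdsWithin] with ε (hε : 0 < ε)
  have hT := measurePreserving_Tcell d hε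
  have htae : ∀ᵐ x : EuclideanSpace ℝ (Fin d), x ∉ t := measure_eq_zero_iff_ae_notMem.1 ht0
  have hTae := Measure.ae_ae_of_ae_prod (hT.quasiMeasurePreserving.ae htae)
  have hF : AEStronglyMeasurable
      (fun z : EuclideanSpace ℝ (Fin d) × EuclideanSpace ℝ (Fin d) =>
        G (Tcell ε z.1 z.2) - G z.1) (volume.prod (volume.restrict (Ycell d))) :=
    ((hGm.comp_measurable hT.measurable).sub
      (hGm.comp_measurable measurable_fst)).aestronglyMeasurable
  have hind {x : EuclideanSpace ℝ (Fin d)} (hx : x ∉ t) (f : EuclideanSpace ℝ (Fin d) → ℝ) :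
      Ω.indicator f x = (Ω \ t).indicator f x := by
    simp [indicator, hx]
  have hosc {x y : EuclideanSpace ℝ (Fin d)} (hy : y ∈ Ycell d) (hxy : Tcell ε x y ∉ t) :
      Ω.indicator (fun x' => v x' (ε⁻¹ • x')) (Tcell ε x y) =
        G (Tcell ε x y) ⟨y, subset_closure hy⟩ := by
    rw [hind hxy, hG_apply]
    by_cases hx : Tcell ε x y ∈ Ω \ t
    · rw [indicator_of_mem hx, indicator_of_mem hx, ← (hgood hx).2 y fun i => ⌊(ε⁻¹ • x) i⌋]
      congr 1
      rw [Tcell, inv_smul_smul₀ hε.ne', add_comm]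
      rfl
    · rw [indicator_of_notMem hx, indicator_of_notMem hx]
  calc _ ≤ ∫⁻ x : EuclideanSpace ℝ (Fin d), ∫⁻ y in Ycell d,
          ‖|Set.indicator Ω (fun x' => v x' (ε⁻¹ • x')) (Tcell ε x y) -
            Set.indicator Ω (fun x' => v x' y) x| ^ r‖ₑ :=
        (enorm_integral_le_lintegral_enorm _).trans
          (lintegral_mono fun _ => enorm_integral_le_lintegral_enorm _)
    _ ≤ ∫⁻ x : EuclideanSpace ℝ (Fin d), ∫⁻ y in Ycell d, ‖G (Tcell ε x y) - G x‖ₑ ^ r := by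
        refine lintegral_mono_ae ?_
        filter_upwards [htae, hTae] with x hx hTx
        refine lintegral_mono_ae ?_
        filter_upwards [hTx, ae_restrict_mem (measurableSet_Ycell d)] with y hxy hy
        rw [Real.enorm_rpow_of_nonneg (abs_nonneg _) hr0.le, ← Real.norm_eq_abs,
          enorm_norm, hosc hy hxy, hind hx,
          ← hG_apply x ⟨y, subset_closure hy⟩, ← ContinuousMap.sub_apply]
        gcongr
        exact enorm_le_iff_norm_le.2 (ContinuousMap.norm_coe_le_norm _ _)
    _ = _ := by
        rw [Function.comp_apply, eLpNorm_eq_lintegral_rpow_enorm_toReal hp0 hp_top, hpr,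
          ← ENNReal.rpow_mul, one_div_mul_cancel hr0.ne', ENNReal.rpow_one,
          lintegral_prod _ (hF.enorm.pow_const r)]
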